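/- arXiv:1712.06553 — 2 statements merged into one kernel-verified Lean document; each statement's English description precedes it below -/
import Mathlib

section
/- Suppose 𝒫 has no facing panels, 𝒫 is nonempty, and the external-edge graph of the full hypercube (the subcube with S = Fin d) is connected. Then there exist k : Fin d and a : Bool such that v k = a for every vertex v in h ∪ h̄; that is, the persistent and salient subcubes are contained in a common codimension-1 face. -/
/-- The subcube `C(S, g)`: vertices agreeing with `g` outside `S`. -/
def Cube {d : ℕ} (S : Set (Fin d)) (g : Fin d → Bool) : Set (Fin d → Bool) :=
  {v | ∀ i ∉ S, v i = g i}

/-- A set of panel data: triples `(i, b, j)` with `i ≠ j`. -/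
def IsPanelData {d : ℕ} (P : Set (Fin d × Bool × Fin d)) : Prop :=
  ∀ p ∈ P, p.1 ≠ p.2.2

/-- The edge at vertex `v` in direction `j` is internal: some panel datum
`(i, b, j) ∈ P` with third coordinate `j` satisfies `v i = b`. -/
def InternalEdge {d : ℕ} (P : Set (Fin d × Bool × Fin d)) (v : Fin d → Bool) (j : Fin d) : Prop :=
  ∃ p ∈ P, p.2.2 = j ∧ v p.1 = p.2.1

/-- The edge at vertex `v` in direction `j` is external. -/
def ExternalEdge {d : ℕ} (P : Set (Fin d × Bool × Fin d)) (v : Fin d → Bool) (j : Fin d) : Prop :=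
  ¬ InternalEdge P v j

/-- `P` has no facing panels. -/
def NoFacingPanels {d : ℕ} (P : Set (Fin d × Bool × Fin d)) : Prop :=
  ¬ ∃ i : Fin d, (∃ j, (i, true, j) ∈ P) ∧ (∃ j', (i, false, j') ∈ P)

/-- A persistent corner: every incident edge is external. -/
def PersistentCorner {d : ℕ} (P : Set (Fin d × Bool × Fin d)) (v : Fin d → Bool) : Prop :=
  ∀ j : Fin d, ExternalEdge P v j

/-- The subcube `C(S, g)` is internal. -/
def InternalCube {d : ℕ} (P : Set (Fin d × Bool × Fin d)) (S : Set (Fin d))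
    (g : Fin d → Bool) : Prop :=
  ∃ p ∈ P, p.2.2 ∈ S ∧ p.1 ∉ S ∧ g p.1 = p.2.1

/-- The subcube `C(S, g)` is external. -/
def ExternalCube {d : ℕ} (P : Set (Fin d × Bool × Fin d)) (S : Set (Fin d))
    (g : Fin d → Bool) : Prop :=
  ¬ InternalCube P S g

/-- The subcube `C(S, g)` is completely external: every edge of it is external. -/
def CompletelyExternal {d : ℕ} (P : Set (Fin d × Bool × Fin d)) (S : Set (Fin d))
    (g : Fin d → Bool) : Prop :=
  ∀ v ∈ Cube S g, ∀ j ∈ S, ExternalEdge P v j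

/-- The external-edge graph of the subcube `C(S, g)`. -/
def extGraph {d : ℕ} (P : Set (Fin d × Bool × Fin d)) (S : Set (Fin d))
    (g : Fin d → Bool) : SimpleGraph (Cube S g) :=
  SimpleGraph.fromRel (fun v w =>
    ∃ j : Fin d, (w : Fin d → Bool) = Function.update (v : Fin d → Bool) j (!(v : Fin d → Bool) j)
      ∧ ExternalEdge P (v : Fin d → Bool) j)

/-- The persistent subcube `h`. -/
def persistentCube {d : ℕ} (P : Set (Fin d × Bool × Fin d)) : Set (Fin d → Bool) :=
  {v | ∀ p ∈ P, v p.1 = !p.2.1}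

open Classical in
/-- The salient subcube `h̄`. -/
def salientCube {d : ℕ} (P : Set (Fin d × Bool × Fin d)) : Set (Fin d → Bool) :=
  {v | ∀ p ∈ P, v p.1 = if ∃ q r, (q, r, p.1) ∈ P then p.2.1 else !p.2.1}

/-- Crossing an edge in direction `j` does not change whether that edge is external. -/
theorem externalEdge_update_iff {d : ℕ} {P : Set (Fin d × Bool × Fin d)} (hP : IsPanelData P)
    (v : Fin d → Bool) (j : Fin d) (c : Bool) :
    ExternalEdge P (Function.update v j c) j ↔ ExternalEdge P v j := by
  refine not_congr (exists_congr fun p => and_congr_right fun hp => and_congr_right fun hj => ?_)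
  rw [Function.update_of_ne (hj ▸ hP p hp)]

/-- The vertices lying on every panel of `P`. -/
def panelCube {d : ℕ} (P : Set (Fin d × Bool × Fin d)) : Set (Fin d → Bool) :=
  {v | ∀ p ∈ P, v p.1 = p.2.1}

/-- If every panel coordinate is also the direction of a panel datum, then changing `v` along an
external edge does not leave the intersection of all panels. -/
theorem update_mem_panelCube {d : ℕ} {P : Set (Fin d × Bool × Fin d)}
    (hdir : ∀ p ∈ P, ∃ q r, (q, r, p.1) ∈ P) {v : Fin d → Bool} (hv : v ∈ panelCube P)
    {j : Fin d} (hj : ExternalEdge P v j) (c : Bool) : Function.update v j c ∈ panelCube P := by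
  intro p hp
  obtain ⟨q, r, hqr⟩ := hdir p hp
  have hne : p.1 ≠ j := fun h => hj ⟨_, hqr, h, hv _ hqr⟩
  rw [Function.update_of_ne hne, hv p hp]

/-- If every panel coordinate is also the direction of a panel datum, then the intersection of all
panels is closed under adjacency in the external-edge graph. -/
theorem mem_panelCube_of_adj {d : ℕ} {P : Set (Fin d × Bool × Fin d)} (hP : IsPanelData P)
    (hdir : ∀ p ∈ P, ∃ q r, (q, r, p.1) ∈ P) {S : Set (Fin d)} {g : Fin d → Bool}
    {v w : Cube S g} (hadj : (extGraph P S g).Adj v w) (hv : v.1 ∈ panelCube P) :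
    w.1 ∈ panelCube P := by
  rw [extGraph, SimpleGraph.fromRel_adj] at hadj
  obtain ⟨-, ⟨j, hw, hj⟩ | ⟨j, hw, hj⟩⟩ := hadj
  · rw [hw]
    exact update_mem_panelCube hdir hv hj _
  · have hwv : w.1 = Function.update v.1 j (w.1 j) := by simp [hw]
    rw [hwv]
    refine update_mem_panelCube hdir hv ?_ _
    rw [hw]
    exact (externalEdge_update_iff hP _ _ _).2 hj

/-- If `P` has no facing panels, then all its panels have a common vertex. -/
theorem panelCube_nonempty {d : ℕ} {P : Set (Fin d × Bool × Fin d)} (hnf : NoFacingPanels P) :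
    (panelCube P).Nonempty := by
  classical
  refine ⟨fun i => decide (∃ j, (i, true, j) ∈ P), ?_⟩
  rintro ⟨i, b, j⟩ hp
  cases b
  · exact decide_eq_false fun h => hnf ⟨i, h, j, hp⟩
  · exact decide_eq_true ⟨j, hp⟩

/-- If `P` has no facing panels, is nonempty, and the external-edge graph of the full hypercube is
connected, then some panel coordinate is not the direction of any panel datum. -/
theorem exists_panel_coordinate_not_direction {d : ℕ} {P : Set (Fin d × Bool × Fin d)}
    (hP : IsPanelData P) (hnf : NoFacingPanels P) (hne : P.Nonempty) {g : Fin d → Bool}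
    (hconn : (extGraph P (Set.univ : Set (Fin d)) g).Connected) :
    ∃ p ∈ P, ¬ ∃ q r, (q, r, p.1) ∈ P := by
  by_contra! hdir
  obtain ⟨v, hv⟩ := panelCube_nonempty hnf
  obtain ⟨p, hp⟩ := hne
  let w : Fin d → Bool := fun _ => !p.2.1
  have hcube (u : Fin d → Bool) : u ∈ Cube Set.univ g := fun i hi => (hi trivial).elim
  have hw : w ∈ panelCube P := by
    obtain ⟨walk⟩ := hconn.preconnected ⟨v, hcube v⟩ ⟨w, hcube w⟩
    have closed {a b : Cube Set.univ g} (W : (extGraph P Set.univ g).Walk a b)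
        (ha : a.1 ∈ panelCube P) : b.1 ∈ panelCube P := by
      induction W with
      | nil => exact ha
      | cons h _ ih => exact ih (mem_panelCube_of_adj hP hdir h ha)
    exact closed walk hv
  exact absurd (hw p hp) (by simp [w])

/-- If `P` has no facing panels, is nonempty, and the external-edge
graph of the full hypercube is connected, then the persistent and salient subcubes lie
in a common codimension-1 face. -/
theorem persistent_salient_common_face (d : ℕ) (P : Set (Fin d × Bool × Fin d))
    (hP : IsPanelData P) (hnf : NoFacingPanels P) (hne : P.Nonempty)
    (hconn : (extGraph P (Set.univ : Set (Fin d)) (fun _ => false)).Connected) :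
    ∃ (k : Fin d) (a : Bool), ∀ v ∈ persistentCube P ∪ salientCube P, v k = a := by
  obtain ⟨p, hp, hdir⟩ := exists_panel_coordinate_not_direction hP hnf hne hconn
  refine ⟨p.1, !p.2.1, ?_⟩
  rintro v (hv | hv)
  · exact hv p hp
  · simpa only [if_neg hdir] using hv p hp
end

section
/- Suppose 𝒫 has no facing panels and 𝒫 is nonempty. Let C(S, g) be a completely external subcube that is maximal among completely external subcubes with respect to inclusion of vertex sets, and suppose C(S, g) is not contained in any codimension-1 face that contains a persistent corner. Then the salient subcube h̄ is contained in C(S, g), and h̄ is completely external (every edge both of whose endpoints lie in h̄ is external). -/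
open Classical in
/-- Without facing panels, a face of the form `v k = c` for which no panel datum `(k, c, j)`
exists contains a persistent corner. -/
theorem NoFacingPanels.exists_persistentCorner {d : ℕ} {P : Set (Fin d × Bool × Fin d)}
    (hnf : NoFacingPanels P) {k : Fin d} {c : Bool} (hk : ∀ j, (k, c, j) ∉ P) :
    ∃ v : Fin d → Bool, v k = c ∧ PersistentCorner P v := by
  refine ⟨fun i => if i = k then c else decide (∃ j, (i, false, j) ∈ P), if_pos rfl, ?_⟩
  rintro j ⟨⟨i, b, j'⟩, hp, -, hv⟩
  dsimp only at hv
  split_ifs at hv with hik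
  · subst hik hv
    exact hk _ hp
  · cases b
    · exact of_decide_eq_false hv ⟨j', hp⟩
    · exact hnf ⟨i, ⟨j', hp⟩, of_decide_eq_true hv⟩

/-- In a completely external subcube, a panel datum whose direction lies in `S` sits at a
coordinate outside `S`, on the side opposite to the subcube. -/
theorem CompletelyExternal.notMem_and_ne {d : ℕ} {P : Set (Fin d × Bool × Fin d)}
    {S : Set (Fin d)} {g : Fin d → Bool} (hce : CompletelyExternal P S g)
    {i j : Fin d} {b : Bool} (hp : (i, b, j) ∈ P) (hj : j ∈ S) : i ∉ S ∧ g i ≠ b := by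
  refine ⟨fun hi => ?_, fun hb => hce g (fun _ _ => rfl) j hj ⟨_, hp, rfl, hb⟩⟩
  refine hce (Function.update g i b) (fun k hk => ?_) j hj ⟨_, hp, rfl, by simp⟩
  exact Function.update_of_ne (fun h : k = i => hk (h ▸ hi)) _ _

/-- A subcube none of whose directions occurs as the direction of a panel datum is completely
external. -/
theorem completelyExternal_of_forall_notMem {d : ℕ} {P : Set (Fin d × Bool × Fin d)}
    {S : Set (Fin d)} {g : Fin d → Bool} (h : ∀ p ∈ P, p.2.2 ∉ S) :
    CompletelyExternal P S g := by
  rintro v - j hj ⟨p, hp, rfl, -⟩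
  exact h p hp hj

/-- If `P` has no facing panels and is nonempty, and `C(S, g)` is a
completely external subcube, maximal among completely external subcubes, not contained
in any codimension-1 face containing a persistent corner, then the salient subcube `h̄`
is contained in `C(S, g)` and is completely external. -/
theorem salient_subset_maximal_completelyExternal (d : ℕ) (P : Set (Fin d × Bool × Fin d))
    (hP : IsPanelData P) (hnf : NoFacingPanels P) (hne : P.Nonempty)
    (S : Set (Fin d)) (g : Fin d → Bool)
    (hce : CompletelyExternal P S g)
    (hmax : ∀ (S' : Set (Fin d)) (g' : Fin d → Bool), CompletelyExternal P S' g' →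
      Cube S g ⊆ Cube S' g' → Cube S g = Cube S' g')
    (hface : ¬ ∃ (k : Fin d) (g' : Fin d → Bool), Cube S g ⊆ Cube ({k}ᶜ : Set (Fin d)) g' ∧
      ∃ v ∈ Cube ({k}ᶜ : Set (Fin d)) g', PersistentCorner P v) :
    salientCube P ⊆ Cube S g ∧
      ∀ v ∈ salientCube P, ∀ j : Fin d,
        Function.update v j (!(v j)) ∈ salientCube P → ExternalEdge P v j := by
  have hpanel : ∀ k ∉ S, ∃ j, (k, g k, j) ∈ P := by
    intro k hk
    by_contra! h
    obtain ⟨w, hw, hwP⟩ := hnf.exists_persistentCorner h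
    refine hface ⟨k, g, fun v hv i hi => ?_, w, fun i hi => ?_, hwP⟩
    · exact hv i (by simp_all)
    · obtain rfl : i = k := by simpa using hi
      exact hw
  have hunique : ∀ {i b b' j j'}, (i, b, j) ∈ P → (i, b', j') ∈ P → b = b' := by
    intro i b b' j j' h h'
    cases b <;> cases b' <;> first | rfl | exact (hnf ⟨i, ⟨_, ‹_›⟩, ⟨_, ‹_›⟩⟩).elim
  have hdir : ∀ p ∈ P, p.2.2 ∉ S := by
    rintro ⟨i, b, j⟩ hp hj
    obtain ⟨hi, hb⟩ := hce.notMem_and_ne hp hj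
    obtain ⟨j', hj'⟩ := hpanel i hi
    exact hb (hunique hj' hp)
  have htarget : ∀ i ∉ S, ∃ q r, (q, r, i) ∈ P := by
    intro i hi
    by_contra! h
    have heq := hmax (insert i S) g
      (completelyExternal_of_forall_notMem fun p hp hpS => hpS.elim
        (fun hpi => h p.1 p.2.1 (hpi ▸ hp)) (hdir p hp))
      (fun v hv k hk => hv k fun hkS => hk (Or.inr hkS))
    have hmem : Function.update g i (!g i) ∈ Cube S g := by
      rw [heq]
      intro k hk
      exact Function.update_of_ne (fun hki => hk (Or.inl hki)) _ _
    simpa using hmem i hi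
  refine ⟨fun v hv i hi => ?_, fun v hv j hv' => ?_⟩
  · obtain ⟨j, hj⟩ := hpanel i hi
    exact (hv _ hj).trans (if_pos (htarget i hi))
  · rintro ⟨p, hp, rfl, -⟩
    obtain ⟨j', hj'⟩ := hpanel _ (hdir p hp)
    simpa using (hv' _ hj').trans (hv _ hj').symm
end
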